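/- Let p ∈ (2,∞) and β ∈ (0,1). Let σ(x) = |x|^{β/(p−1)} and w(x) = |x|^{−β} for x ≠ 0 (σ(0)=w(0)=1). Then the operator norm of f ↦ S(fσ) from L^p(σ) to L^p(w) is at least c_p (1−β)^{−1/2}, where c_p > 0 depends only on p, and this holds even when S is only the dyadic square function over the unit interval [0,1). -/

import Mathlib

open MeasureTheory Set Filter
open scoped ENNReal NNReal

noncomputable section

/-- Average of `g` over the interval `[a, b)` (with respect to Lebesgue measure). -/
def avgI (g : ℝ → ℝ) (a b : ℝ) : ℝ := (b - a)⁻¹ * ∫ x in Set.Ico a b, g x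

/-- The dyadic interval `[k·2^{-n}, (k+1)·2^{-n})`. -/
def dyadicI (n k : ℤ) : Set ℝ :=
  Set.Ico ((k : ℝ) * (2:ℝ) ^ (-n)) (((k : ℝ) + 1) * (2:ℝ) ^ (-n))

/-- Average of `g` over the dyadic interval `dyadicI n k`. -/
def avgD (g : ℝ → ℝ) (n k : ℤ) : ℝ :=
  avgI g ((k : ℝ) * (2:ℝ) ^ (-n)) (((k : ℝ) + 1) * (2:ℝ) ^ (-n))

/-- The martingale difference `Δ_Q g` associated with the dyadic interval `Q = dyadicI n k`:
`Δ_Q g = Σ_{R child of Q} ⟨g⟩_R 1_R − ⟨g⟩_Q 1_Q`. -/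
def deltaD (g : ℝ → ℝ) (n k : ℤ) (x : ℝ) : ℝ :=
  (dyadicI (n+1) (2*k)).indicator (fun _ => avgD g (n+1) (2*k)) x
    + (dyadicI (n+1) (2*k+1)).indicator (fun _ => avgD g (n+1) (2*k+1)) x
    - (dyadicI n k).indicator (fun _ => avgD g n k) x

/-- The dyadic square function on `ℝ`. -/
def sqFn (g : ℝ → ℝ) (x : ℝ) : ℝ :=
  Real.sqrt (∑' q : ℤ × ℤ, (deltaD g q.1 q.2 x) ^ 2)

open Classical in
/-- The dyadic square function over `[0,1)`: the sum runs only over dyadic intervals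
contained in `[0,1)`. -/
def sqFn01 (g : ℝ → ℝ) (x : ℝ) : ℝ :=
  Real.sqrt (∑' q : ℤ × ℤ,
    if dyadicI q.1 q.2 ⊆ Set.Ico (0:ℝ) 1 then (deltaD g q.1 q.2 x) ^ 2 else 0)

/-- `‖g‖_{L^p(w)}` (as an extended nonnegative real), `w dx` being the underlying measure. -/
def pNorm (p : ℝ) (g w : ℝ → ℝ) : ℝ≥0∞ :=
  (∫⁻ x : ℝ, ENNReal.ofReal (|g x| ^ p * w x)) ^ (1/p)

/-- `‖g‖_{L^p(w)}` over `[0,1)`. -/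
def pNorm01 (p : ℝ) (g w : ℝ → ℝ) : ℝ≥0∞ :=
  (∫⁻ x in Set.Ico (0:ℝ) 1, ENNReal.ofReal (|g x| ^ p * w x)) ^ (1/p)

/-- The joint `A_p` characteristic `[w,σ]_{A_p}`, the supremum running over all bounded
intervals of `ℝ`. -/
def apChar (p : ℝ) (w σ : ℝ → ℝ) : ℝ≥0∞ :=
  ⨆ (a : ℝ) (b : ℝ) (_ : a < b),
    ENNReal.ofReal (avgI w a b * (avgI σ a b) ^ (p - 1))

/-- The joint `A_p` characteristic `[w,σ]_{A_p}`, the supremum running over all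
subintervals of `[0,1)`. -/
def apChar01 (p : ℝ) (w σ : ℝ → ℝ) : ℝ≥0∞ :=
  ⨆ (a : ℝ) (b : ℝ) (_ : 0 ≤ a) (_ : a < b) (_ : b ≤ 1),
    ENNReal.ofReal (avgI w a b * (avgI σ a b) ^ (p - 1))

/-- The local maximal function `M_{[a,b)} σ (x) = sup { ⟨σ⟩_R : R interval ⊆ [a,b), x ∈ R }`. -/
def maxFn (σ : ℝ → ℝ) (a b x : ℝ) : ℝ≥0∞ :=
  ⨆ (c : ℝ) (e : ℝ) (_ : a ≤ c) (_ : c < e) (_ : e ≤ b) (_ : x ∈ Set.Ico c e),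
    ENNReal.ofReal (avgI σ c e)

/-- The Fujii–Wilson `A_∞` characteristic
`[σ]_{A_∞} = sup_Q (1/σ(Q)) ∫_Q M_Q σ`, the supremum over bounded intervals of `ℝ`. -/
def ainfChar (σ : ℝ → ℝ) : ℝ≥0∞ :=
  ⨆ (a : ℝ) (b : ℝ) (_ : a < b),
    (∫⁻ x in Set.Ico a b, maxFn σ a b x) / ENNReal.ofReal (∫ x in Set.Ico a b, σ x)

/-- A weight on `ℝ`: measurable, a.e. positive, integrable over every bounded interval. -/
def IsWeight (w : ℝ → ℝ) : Prop :=
  Measurable w ∧ (∀ᵐ x : ℝ, 0 < w x) ∧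
    ∀ a b : ℝ, a < b → IntegrableOn w (Set.Ico a b)

/-- A weight on `[0,1)`: measurable, a.e. positive on `[0,1)`, integrable over `[0,1)`. -/
def IsWeight01 (w : ℝ → ℝ) : Prop :=
  Measurable w ∧ (∀ᵐ x : ℝ, x ∈ Set.Ico (0:ℝ) 1 → 0 < w x) ∧
    IntegrableOn w (Set.Ico (0:ℝ) 1)


/-- The function equal to `(-1) ^ j` on each dyadic annulus `[2 ^ j, 2 ^ (j + 1))`. -/
def altSign (x : ℝ) : ℝ := (-1 : ℝ) ^ ⌊Real.logb 2 x⌋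

lemma measurable_altSign : Measurable altSign := by
  have h : Measurable fun x : ℝ => ⌊Real.logb 2 x⌋ :=
    (Real.measurable_log.div_const _).floor
  exact (measurable_of_countable fun j : ℤ => (-1 : ℝ) ^ j).comp h

lemma abs_altSign (x : ℝ) : |altSign x| = 1 := by
  simp [altSign, abs_zpow]

lemma altSign_of_mem {j : ℤ} {x : ℝ} (h₁ : (2 : ℝ) ^ j ≤ x) (h₂ : x < (2 : ℝ) ^ (j + 1)) :
    altSign x = (-1) ^ j := by
  have hx : 0 < x := lt_of_lt_of_le (by positivity) h₁
  have : ⌊Real.logb 2 x⌋ = j := by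
    rw [Int.floor_eq_iff]
    constructor
    · rw [Real.le_logb_iff_rpow_le one_lt_two hx, Real.rpow_intCast]; exact h₁
    · rw [Real.logb_lt_iff_lt_rpow one_lt_two hx]
      exact_mod_cast h₂
  rw [altSign, this]

lemma altSign_two_mul {x : ℝ} (hx : 0 < x) : altSign (2 * x) = -altSign x := by
  have : Real.logb 2 (2 * x) = Real.logb 2 x + 1 := by
    rw [Real.logb_mul two_ne_zero hx.ne', Real.logb_self_eq_one one_lt_two, add_comm]
  rw [altSign, altSign, this, Int.floor_add_one, zpow_add₀ (by norm_num)]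
  simp

lemma intervalIntegrable_altSign (a b : ℝ) : IntervalIntegrable altSign volume a b := by
  refine (intervalIntegrable_const (c := (1 : ℝ))).mono_fun
    measurable_altSign.aestronglyMeasurable ?_
  exact Eventually.of_forall fun x => by simp [abs_altSign]

lemma integral_altSign_half {b : ℝ} (hb : 0 ≤ b) :
    ∫ x in (0 : ℝ)..b / 2, altSign x = -(1 / 2) * ∫ x in (0 : ℝ)..b, altSign x := by
  have h := intervalIntegral.integral_comp_mul_left (a := 0) (b := b / 2) altSign
    (two_ne_zero (α := ℝ))
  have h' : ∫ x in (0 : ℝ)..b / 2, altSign (2 * x) = ∫ x in (0 : ℝ)..b / 2, -altSign x := by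
    refine intervalIntegral.integral_congr_ae (Eventually.of_forall fun x hx => ?_)
    rw [uIoc_of_le (by positivity)] at hx
    exact altSign_two_mul hx.1
  rw [h', intervalIntegral.integral_neg, mul_zero, mul_div_cancel₀ _ two_ne_zero, smul_eq_mul] at h
  linarith

lemma avgI_of_const {g : ℝ → ℝ} {a b c : ℝ} (hab : a < b) (h : ∀ x ∈ Ico a b, g x = c) :
    avgI g a b = c := by
  rw [avgI, setIntegral_congr_fun measurableSet_Ico h]
  simp only [integral_const, MeasurableSet.univ, measureReal_restrict_apply, univ_inter,
    smul_eq_mul, Real.volume_real_Ico_of_le hab.le]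
  rw [inv_mul_cancel_left₀ (sub_pos.2 hab).ne']

lemma avgD_of_const {g : ℝ → ℝ} {n k : ℤ} {c : ℝ} (h : ∀ x ∈ dyadicI n k, g x = c) :
    avgD g n k = c := by
  refine avgI_of_const ?_ h
  have : (0 : ℝ) < 2 ^ (-n) := by positivity
  nlinarith

lemma two_zpow_neg_eq (n : ℤ) : (2 : ℝ) ^ (-n) = 2 * 2 ^ (-(n + 1)) := by
  rw [show -n = 1 + -(n + 1) by ring, zpow_add₀ two_ne_zero, zpow_one]

lemma neg_one_zpow_neg_succ (n : ℤ) : (-1 : ℝ) ^ (-(n + 1)) = -(-1) ^ n := by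
  rw [zpow_neg, ← inv_zpow, inv_neg_one, zpow_add₀ (by norm_num), zpow_one, mul_neg_one]

lemma integral_altSign_zpow (n : ℤ) :
    ∫ x in (0 : ℝ)..2 ^ (-n), altSign x = -(-1) ^ n / 3 * 2 ^ (-n) := by
  have hpos : (0 : ℝ) < 2 ^ (-(n + 1)) := by positivity
  have hhalf := integral_altSign_half (b := (2 : ℝ) ^ (-n)) (by positivity)
  rw [two_zpow_neg_eq n, mul_div_cancel_left₀ _ (two_ne_zero (α := ℝ))] at hhalf
  have hadd := intervalIntegral.integral_add_adjacent_intervals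
    (intervalIntegrable_altSign 0 (2 ^ (-(n + 1))))
    (intervalIntegrable_altSign (2 ^ (-(n + 1))) (2 * 2 ^ (-(n + 1))))
  have hconst : ∫ x in (2 : ℝ) ^ (-(n + 1))..2 * 2 ^ (-(n + 1)), altSign x
      = -(-1) ^ n * 2 ^ (-(n + 1)) := by
    rw [intervalIntegral.integral_of_le (by linarith), ← integral_Ico_eq_integral_Ioc,
      setIntegral_congr_fun (g := fun _ => (-1 : ℝ) ^ (-(n + 1))) measurableSet_Ico]
    · simp only [integral_const, MeasurableSet.univ, measureReal_restrict_apply, univ_inter,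
        smul_eq_mul]
      rw [Real.volume_real_Ico_of_le (by linarith), neg_one_zpow_neg_succ]
      ring
    · intro x hx
      refine altSign_of_mem hx.1 (hx.2.trans_le (le_of_eq ?_))
      rw [← two_zpow_neg_eq, neg_add, neg_add_cancel_right]
  rw [two_zpow_neg_eq n]
  linarith

lemma avgD_altSign_zero (n : ℤ) : avgD altSign n 0 = -(-1) ^ n / 3 := by
  have hpos : (0 : ℝ) < 2 ^ (-n) := by positivity
  have h := integral_altSign_zpow n
  rw [intervalIntegral.integral_of_le hpos.le, ← integral_Ico_eq_integral_Ioc] at h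
  simp only [avgD, avgI, Int.cast_zero, zero_mul, zero_add, one_mul, sub_zero, h]
  field_simp

lemma dyadicI_left_subset (n k : ℤ) : dyadicI (n + 1) (2 * k) ⊆ dyadicI n k := by
  have hpos : (0 : ℝ) < 2 ^ (-(n + 1)) := by positivity
  rw [dyadicI, dyadicI, two_zpow_neg_eq n]
  refine Ico_subset_Ico ?_ ?_ <;> push_cast <;> nlinarith

lemma dyadicI_right_subset (n k : ℤ) : dyadicI (n + 1) (2 * k + 1) ⊆ dyadicI n k := by
  have hpos : (0 : ℝ) < 2 ^ (-(n + 1)) := by positivity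
  rw [dyadicI, dyadicI, two_zpow_neg_eq n]
  refine Ico_subset_Ico ?_ ?_ <;> push_cast <;> nlinarith

lemma mem_dyadicI_left_iff {n k : ℤ} {x : ℝ} (hx : x ∈ dyadicI n k) :
    x ∈ dyadicI (n + 1) (2 * k) ↔ x ∉ dyadicI (n + 1) (2 * k + 1) := by
  rw [dyadicI, two_zpow_neg_eq n] at hx
  obtain ⟨h₁, h₂⟩ := hx
  simp only [dyadicI, mem_Ico, not_and_or, not_le, not_lt]
  push_cast
  constructor
  · exact fun h => Or.inl h.2
  · rintro (h | h)
    · exact ⟨by linarith, h⟩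
    · linarith

lemma deltaD_of_mem_left {g : ℝ → ℝ} {n k : ℤ} {x : ℝ} (hx : x ∈ dyadicI (n + 1) (2 * k)) :
    deltaD g n k x = avgD g (n + 1) (2 * k) - avgD g n k := by
  have h := dyadicI_left_subset n k hx
  simp [deltaD, hx, h, (mem_dyadicI_left_iff h).1 hx]

lemma deltaD_of_mem_right {g : ℝ → ℝ} {n k : ℤ} {x : ℝ}
    (hx : x ∈ dyadicI (n + 1) (2 * k + 1)) :
    deltaD g n k x = avgD g (n + 1) (2 * k + 1) - avgD g n k := by
  have h := dyadicI_right_subset n k hx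
  have h' : x ∉ dyadicI (n + 1) (2 * k) := fun h' => (mem_dyadicI_left_iff h).1 h' hx
  simp [deltaD, hx, h, h']

lemma deltaD_of_notMem {g : ℝ → ℝ} {n k : ℤ} {x : ℝ} (hx : x ∉ dyadicI n k) :
    deltaD g n k x = 0 := by
  have h₁ : x ∉ dyadicI (n + 1) (2 * k) := fun h => hx (dyadicI_left_subset n k h)
  have h₂ : x ∉ dyadicI (n + 1) (2 * k + 1) := fun h => hx (dyadicI_right_subset n k h)
  simp [deltaD, hx, h₁, h₂]

lemma deltaD_of_const {g : ℝ → ℝ} {n k : ℤ} {c : ℝ} (h : ∀ y ∈ dyadicI n k, g y = c) (x : ℝ) :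
    deltaD g n k x = 0 := by
  by_cases hx : x ∈ dyadicI n k
  · by_cases hr : x ∈ dyadicI (n + 1) (2 * k + 1)
    · rw [deltaD_of_mem_right hr, avgD_of_const h,
        avgD_of_const fun y hy => h y (dyadicI_right_subset n k hy), sub_self]
    · rw [deltaD_of_mem_left ((mem_dyadicI_left_iff hx).2 hr), avgD_of_const h,
        avgD_of_const fun y hy => h y (dyadicI_left_subset n k hy), sub_self]
  · exact deltaD_of_notMem hx

lemma sq_deltaD_altSign_zero {n : ℤ} {x : ℝ} (hx : x ∈ dyadicI n 0) :
    deltaD altSign n 0 x ^ 2 = 4 / 9 := by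
  have hsq : ((-1 : ℝ) ^ n) ^ 2 = 1 := by
    rw [← zpow_natCast, ← zpow_mul, mul_comm, zpow_mul]; norm_num
  have hsucc : (-1 : ℝ) ^ (n + 1) = -(-1) ^ n := by
    rw [zpow_add₀ (by norm_num), zpow_one, mul_neg_one]
  by_cases hr : x ∈ dyadicI (n + 1) (2 * 0 + 1)
  · have hc : avgD altSign (n + 1) (2 * 0 + 1) = (-1 : ℝ) ^ (-(n + 1)) := by
      refine avgD_of_const fun y hy => ?_
      simp only [dyadicI, mem_Ico] at hy
      push_cast at hy
      refine altSign_of_mem (by linarith [hy.1]) (hy.2.trans_le (le_of_eq ?_))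
      rw [neg_add, neg_add_cancel_right, two_zpow_neg_eq n, neg_add]
      ring
    rw [deltaD_of_mem_right hr, hc, avgD_altSign_zero, neg_one_zpow_neg_succ]
    nlinarith
  · rw [deltaD_of_mem_left ((mem_dyadicI_left_iff hx).2 hr), mul_zero, avgD_altSign_zero,
      avgD_altSign_zero, hsucc]
    nlinarith

lemma deltaD_altSign_eq_zero {k : ℕ} {n m : ℤ} {x : ℝ} (h₁ : (2 : ℝ) ^ (-((k : ℤ) + 1)) ≤ x)
    (h₂ : x < (2 : ℝ) ^ (-(k : ℤ))) (hm : 0 < m) : deltaD altSign n m x = 0 := by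
  by_cases hx : x ∈ dyadicI n m
  swap
  · exact deltaD_of_notMem hx
  obtain ⟨hl, hr⟩ := hx
  have hpos : (0 : ℝ) < 2 ^ (-n) := by positivity
  have hm' : (1 : ℝ) ≤ m := by exact_mod_cast hm
  have hkn : (k : ℤ) < n := by
    have : (2 : ℝ) ^ (-n) < 2 ^ (-(k : ℤ)) := by nlinarith
    have := (zpow_lt_zpow_iff_right₀ (one_lt_two (α := ℝ))).1 this
    omega
  obtain ⟨d, rfl⟩ : ∃ d : ℕ, n = k + 1 + d := ⟨(n - k - 1).toNat, by omega⟩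
  have hk₁ : (2 : ℝ) ^ (-((k : ℤ) + 1)) = 2 ^ d * 2 ^ (-((k : ℤ) + 1 + d)) := by
    rw [← zpow_natCast, ← zpow_add₀ two_ne_zero]; congr 1; ring
  have hk₀ : (2 : ℝ) ^ (-(k : ℤ)) = 2 ^ (d + 1) * 2 ^ (-((k : ℤ) + 1 + d)) := by
    rw [← zpow_natCast, ← zpow_add₀ two_ne_zero]; congr 1; push_cast; ring
  have hlow : (2 : ℤ) ^ d < m + 1 := by
    have : (2 : ℝ) ^ d < m + 1 := lt_of_mul_lt_mul_right (by linarith) hpos.le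
    exact_mod_cast this
  have hupp : m < (2 : ℤ) ^ (d + 1) := by
    have : (m : ℝ) < 2 ^ (d + 1) := lt_of_mul_lt_mul_right (by linarith) hpos.le
    exact_mod_cast this
  have hlow' : (2 : ℝ) ^ d ≤ m := by exact_mod_cast Int.lt_add_one_iff.1 hlow
  have hupp' : (m : ℝ) + 1 ≤ 2 ^ (d + 1) := by exact_mod_cast Int.add_one_le_of_lt hupp
  refine deltaD_of_const (c := (-1 : ℝ) ^ (-((k : ℤ) + 1))) (fun y hy => ?_) x
  refine altSign_of_mem ?_ ?_
  · rw [hk₁]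
    exact (mul_le_mul_of_nonneg_right hlow' hpos.le).trans hy.1
  · rw [neg_add, neg_add_cancel_right, hk₀]
    exact hy.2.trans_le (mul_le_mul_of_nonneg_right hupp' hpos.le)

lemma sqFn01_altSign {k : ℕ} {x : ℝ} (h₁ : (2 : ℝ) ^ (-((k : ℤ) + 1)) ≤ x)
    (h₂ : x < (2 : ℝ) ^ (-(k : ℤ))) :
    sqFn01 altSign x = √((k + 1) * (4 / 9)) := by
  have hx : 0 < x := lt_of_lt_of_le (by positivity) h₁
  have hinj : Function.Injective fun n : ℕ => ((n : ℤ), (0 : ℤ)) := fun a b h => by simpa using h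
  rw [sqFn01]
  congr 1
  rw [tsum_eq_sum (s := (Finset.range (k + 1)).map ⟨_, hinj⟩), Finset.sum_map]
  · rw [Finset.sum_congr rfl (g := fun _ => (4 / 9 : ℝ))]
    · simp
    · intro n hn
      have hn' : n ≤ k := by simpa [Nat.lt_succ_iff] using hn
      have hsub : dyadicI n 0 ⊆ Ico (0 : ℝ) 1 := by
        simp only [dyadicI, Int.cast_zero, zero_mul, zero_add, one_mul]
        exact Ico_subset_Ico_right (zpow_le_one_of_nonpos₀ one_le_two (by simp))
      simp only [Function.Embedding.coeFn_mk, if_pos hsub]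
      refine sq_deltaD_altSign_zero ?_
      simp only [dyadicI, Int.cast_zero, zero_mul, zero_add, one_mul]
      exact ⟨hx.le, h₂.trans_le (zpow_le_zpow_right₀ one_le_two (by omega))⟩
  · rintro ⟨n, m⟩ hq
    split_ifs with hsub
    swap
    · rfl
    rw [sq_eq_zero_iff]
    have hpos : (0 : ℝ) < 2 ^ (-n) := by positivity
    simp only [dyadicI] at hsub
    rw [Ico_subset_Ico_iff (by nlinarith)] at hsub
    obtain ⟨hm₀, hm₁⟩ := hsub
    have hm : 0 ≤ m := by
      have : (0 : ℝ) ≤ m := nonneg_of_mul_nonneg_left hm₀ hpos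
      exact_mod_cast this
    rcases hm.eq_or_lt with rfl | hm
    · refine deltaD_of_notMem fun hmem => hq ?_
      simp only [dyadicI, Int.cast_zero, zero_mul, zero_add, one_mul, mem_Ico] at hmem hm₁
      have hn₀ : 0 ≤ n := by
        have := (zpow_le_one_iff_right₀ (one_lt_two (α := ℝ))).1 hm₁
        omega
      have hnk : n < k + 1 := by
        have := (zpow_lt_zpow_iff_right₀ (one_lt_two (α := ℝ))).1 (h₁.trans_lt hmem.2)
        omega
      simp only [Finset.mem_map, Finset.mem_range, Function.Embedding.coeFn_mk, Prod.mk.injEq]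
      exact ⟨n.toNat, by omega, by omega, trivial⟩
    · exact deltaD_altSign_eq_zero h₁ h₂ hm

lemma le_sqFn01_altSign {N : ℕ} {x : ℝ} (hx : 0 < x) (hxN : x < (2 : ℝ) ^ (-(N : ℤ))) :
    2 / 3 * √(N + 1) ≤ sqFn01 altSign x := by
  obtain ⟨j, hj₁, hj₂⟩ := exists_mem_Ico_zpow hx (one_lt_two (α := ℝ))
  have hjN : j < -(N : ℤ) :=
    (zpow_lt_zpow_iff_right₀ (one_lt_two (α := ℝ))).1 (hj₁.trans_lt hxN)
  obtain ⟨k, rfl⟩ : ∃ k : ℕ, j = -((k : ℤ) + 1) := ⟨(-j - 1).toNat, by omega⟩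
  rw [sqFn01_altSign hj₁ (by simpa using hj₂)]
  have hNk : (N : ℝ) ≤ k := by exact_mod_cast (by omega : N ≤ k)
  refine Real.le_sqrt_of_sq_le ?_
  rw [mul_pow, Real.sq_sqrt (by positivity)]
  nlinarith

lemma lintegral_Ioo_rpow_neg {β δ : ℝ} (hβ : β < 1) (hδ : 0 ≤ δ) :
    ∫⁻ x in Ioo (0 : ℝ) δ, ENNReal.ofReal (x ^ (-β)) =
      ENNReal.ofReal (δ ^ (1 - β) / (1 - β)) := by
  have hint : IntervalIntegrable (fun x : ℝ => x ^ (-β)) volume 0 δ :=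
    intervalIntegral.intervalIntegrable_rpow' (by linarith)
  rw [← ofReal_integral_eq_lintegral_ofReal]
  · rw [← integral_Ioc_eq_integral_Ioo, ← intervalIntegral.integral_of_le hδ,
      integral_rpow (Or.inl (by linarith)), Real.zero_rpow (by linarith), sub_zero,
      neg_add_eq_sub]
  · exact ((intervalIntegrable_iff_integrableOn_Ioc_of_le hδ).1 hint).mono_set Ioo_subset_Ioc_self
  · exact (ae_restrict_mem measurableSet_Ioo).mono fun x hx => Real.rpow_nonneg hx.1.le _

lemma le_pNorm01_sqFn01_altSign {p β : ℝ} (hp : 1 ≤ p) (hβ : β ∈ Ioo (0 : ℝ) 1) :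
    ENNReal.ofReal (1 / 3 * (1 - β) ^ (-(1 / 2 : ℝ))) *
        ENNReal.ofReal (1 / (1 - β)) ^ (1 / p) ≤
      pNorm01 p (sqFn01 altSign) (fun x => if x = 0 then 1 else |x| ^ (-β)) := by
  have hε : 0 < 1 - β := sub_pos.2 hβ.2
  have hp₀ : 0 < p := by linarith
  set N : ℕ := ⌊1 / (1 - β)⌋₊
  have hN₁ : (N : ℝ) ≤ 1 / (1 - β) := Nat.floor_le (by positivity)
  have hN₂ : 1 / (1 - β) ≤ (N : ℝ) + 1 := (Nat.lt_floor_add_one _).le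
  set δ : ℝ := (2 : ℝ) ^ (-(N : ℤ)) with hδ
  have hδ₀ : 0 < δ := by positivity
  have hδ₁ : δ ≤ 1 := zpow_le_one_of_nonpos₀ one_le_two (by simp)
  have hδε : 1 / 2 ≤ δ ^ (1 - β) := by
    have : δ = (2 : ℝ) ^ (-(N : ℝ)) := by rw [hδ, ← Real.rpow_intCast]; simp
    rw [this, ← Real.rpow_mul zero_le_two, one_div, ← Real.rpow_neg_one]
    refine Real.rpow_le_rpow_of_exponent_le one_le_two ?_
    rw [le_div_iff₀ hε] at hN₁
    linarith
  have hsqrt : (1 - β) ^ (-(1 / 2 : ℝ)) ≤ √(N + 1) := by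
    rw [Real.sqrt_eq_rpow, Real.rpow_neg hε.le, ← Real.inv_rpow hε.le, ← one_div (1 - β)]
    exact Real.rpow_le_rpow (by positivity) hN₂ (by norm_num)
  have hhalf : (1 / 2 : ℝ) ≤ (1 / 2) ^ (1 / p) :=
    Real.self_le_rpow_of_le_one (by norm_num) (by norm_num) ((div_le_one hp₀).2 hp)
  set A : ℝ := 2 / 3 * √(N + 1) with hA
  have hA₀ : 0 ≤ A := by positivity
  have hint : ENNReal.ofReal (A ^ p) * ENNReal.ofReal (δ ^ (1 - β) / (1 - β)) ≤
      ∫⁻ x in Ico (0 : ℝ) 1,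
        ENNReal.ofReal (|sqFn01 altSign x| ^ p * if x = 0 then 1 else |x| ^ (-β)) := by
    rw [← lintegral_Ioo_rpow_neg hβ.2 hδ₀.le, ← lintegral_const_mul' _ _ ENNReal.ofReal_ne_top]
    refine (setLIntegral_mono' measurableSet_Ioo fun x hx => ?_).trans
      (lintegral_mono_set ((Ioo_subset_Ioo_right hδ₁).trans Ioo_subset_Ico_self))
    rw [← ENNReal.ofReal_mul (by positivity), if_neg hx.1.ne', abs_of_pos hx.1]
    have hS := le_sqFn01_altSign hx.1 hx.2
    exact ENNReal.ofReal_le_ofReal (mul_le_mul_of_nonneg_right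
      (Real.rpow_le_rpow hA₀ (hS.trans (le_abs_self _)) hp₀.le) (Real.rpow_nonneg hx.1.le _))
  refine le_trans ?_ (ENNReal.rpow_le_rpow hint (by positivity))
  rw [ENNReal.mul_rpow_of_nonneg _ _ (by positivity),
    ENNReal.ofReal_rpow_of_nonneg (by positivity) (by positivity),
    ENNReal.ofReal_rpow_of_nonneg (by positivity) (by positivity),
    ENNReal.ofReal_rpow_of_nonneg (by positivity) (by positivity),
    ← ENNReal.ofReal_mul (by positivity), ← ENNReal.ofReal_mul (by positivity)]
  refine ENNReal.ofReal_le_ofReal ?_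
  rw [one_div p, Real.rpow_rpow_inv hA₀ hp₀.ne', ← one_div p, ← mul_one_div (δ ^ (1 - β)),
    Real.mul_rpow (by positivity) (by positivity), ← mul_assoc]
  refine mul_le_mul_of_nonneg_right ?_ (by positivity)
  have hδp : (1 / 2 : ℝ) ≤ (δ ^ (1 - β)) ^ (1 / p) :=
    hhalf.trans (Real.rpow_le_rpow (by norm_num) hδε (by positivity))
  calc 1 / 3 * (1 - β) ^ (-(1 / 2 : ℝ)) ≤ A * (1 / 2) := by rw [hA]; linarith
    _ ≤ A * (δ ^ (1 - β)) ^ (1 / p) := mul_le_mul_of_nonneg_left hδp hA₀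

lemma pNorm01_altSign_div {p β : ℝ} (hp : 1 < p) (hβ : β < 1) :
    pNorm01 p (fun x => altSign x / (if x = 0 then 1 else |x| ^ (β / (p - 1))))
      (fun x => if x = 0 then 1 else |x| ^ (β / (p - 1))) =
      ENNReal.ofReal (1 / (1 - β)) ^ (1 / p) := by
  have h := lintegral_Ioo_rpow_neg hβ zero_le_one
  rw [Real.one_rpow] at h
  rw [pNorm01, ← h, setLIntegral_congr Ioo_ae_eq_Ico.symm]
  congr 1
  refine setLIntegral_congr_fun measurableSet_Ioo fun x hx => ?_
  have hx₀ : 0 < x := hx.1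
  have hp' : p - 1 ≠ 0 := by linarith
  simp only [if_neg hx₀.ne', abs_div, abs_altSign, abs_of_pos hx₀,
    abs_of_pos (Real.rpow_pos_of_pos hx₀ _)]
  rw [one_div, ← Real.rpow_neg hx₀.le, ← Real.rpow_mul hx₀.le, ← Real.rpow_add hx₀]
  congr 2
  field_simp
  ring

/-- For `p ∈ (2,∞)`, `β ∈ (0,1)`, `σ(x) = |x|^{β/(p-1)}`,
`w(x) = |x|^{-β}` (with `σ(0) = w(0) = 1`), the operator norm of
`f ↦ S(fσ) : L^p(σ) → L^p(w)` is at least `c_p (1-β)^{-1/2}` with `c_p > 0`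
depending only on `p`, even when `S` is only the dyadic square function over `[0,1)`. -/
theorem statement9 (p : ℝ) (hp : 2 < p) :
    ∃ c > (0:ℝ), ∀ β ∈ Set.Ioo (0:ℝ) 1, ∀ C : ℝ≥0∞,
      (∀ f : ℝ → ℝ, Measurable f →
        pNorm01 p (sqFn01 (fun x => f x * (if x = 0 then 1 else |x| ^ (β / (p - 1)))))
            (fun x => if x = 0 then 1 else |x| ^ (-β)) ≤
          C * pNorm01 p f (fun x => if x = 0 then 1 else |x| ^ (β / (p - 1)))) →
      ENNReal.ofReal (c * (1 - β) ^ (-(1/2 : ℝ))) ≤ C := by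
  refine ⟨1 / 3, by norm_num, fun β hβ C hC => ?_⟩
  have hε : 0 < 1 / (1 - β) := one_div_pos.2 (sub_pos.2 hβ.2)
  have hσ : Measurable fun x : ℝ => if x = 0 then (1 : ℝ) else |x| ^ (β / (p - 1)) :=
    Measurable.ite (measurableSet_singleton 0) measurable_const (by fun_prop)
  have h := hC (fun x => altSign x / (if x = 0 then 1 else |x| ^ (β / (p - 1))))
    (measurable_altSign.div hσ)
  have hg : (fun x : ℝ => altSign x / (if x = 0 then 1 else |x| ^ (β / (p - 1))) *
      (if x = 0 then 1 else |x| ^ (β / (p - 1)))) = altSign := by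
    funext x
    refine div_mul_cancel₀ _ ?_
    split_ifs with hx
    · exact one_ne_zero
    · positivity
  rw [hg] at h
  have h' := (le_pNorm01_sqFn01_altSign (by linarith) hβ).trans h
  rw [pNorm01_altSign_div (by linarith) hβ.2] at h'
  refine (ENNReal.mul_le_mul_iff_left ?_ ?_).1 h'
  · exact (ENNReal.rpow_pos (ENNReal.ofReal_pos.2 hε) ENNReal.ofReal_ne_top).ne'
  · exact ENNReal.rpow_ne_top_of_nonneg (by positivity) ENNReal.ofReal_ne_top

end
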